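/- arXiv:2008.07472 — 2 statements merged into one kernel-verified Lean document; each statement's English description precedes it below -/
import Mathlib

section
/- Let n ≥ 1 and let Q be a nonempty subset of ℝⁿ₊. Then there exists a unique vector q* ∈ (ℝⁿ₊)↓ such that q* ≺_w q for all q ∈ Q, and such that every p ∈ ℝⁿ₊ satisfying p ≺_w q for all q ∈ Q also satisfies p ≺_w q*. -/
open Matrix
open scoped ComplexOrder

/-- Sum of the `k` largest entries of `p` (as a supremum of sums over `k`-subsets). -/
noncomputable def sumLargest {n : ℕ} (p : Fin n → ℝ) (k : ℕ) : ℝ :=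
  sSup ((fun A : Finset (Fin n) => ∑ i ∈ A, p i) '' {A : Finset (Fin n) | A.card = k})

/-- `p` is weakly majorized by `q`. -/
def WeakMaj {n : ℕ} (p q : Fin n → ℝ) : Prop :=
  ∀ k : ℕ, 1 ≤ k → k ≤ n → sumLargest p k ≤ sumLargest q k

/-- `p` is majorized by `q`. -/
def Maj {n : ℕ} (p q : Fin n → ℝ) : Prop :=
  WeakMaj p q ∧ ∑ i, p i = ∑ i, q i

/-- `p` has nonnegative entries arranged in decreasing order. -/
def DecrNonneg {n : ℕ} (p : Fin n → ℝ) : Prop :=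
  Antitone p ∧ ∀ i, 0 ≤ p i

/-- The decreasing rearrangement of a vector. -/
noncomputable def decrRearrange {n : ℕ} (p : Fin n → ℝ) : Fin n → ℝ :=
  fun i => p (Tuple.sort p (Fin.rev i))

/-- `x` is the supremum of `S` in the weak-majorization order (w-sup). -/
def IsWSup {n : ℕ} (S : Set (Fin n → ℝ)) (x : Fin n → ℝ) : Prop :=
  DecrNonneg x ∧ (∀ s ∈ S, WeakMaj s x) ∧
    ∀ p : Fin n → ℝ, (∀ i, 0 ≤ p i) → (∀ s ∈ S, WeakMaj s p) → WeakMaj x p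

/-- `x` is the infimum of `Q` in the weak-majorization order (w-inf). -/
def IsWInf {n : ℕ} (Q : Set (Fin n → ℝ)) (x : Fin n → ℝ) : Prop :=
  DecrNonneg x ∧ (∀ q ∈ Q, WeakMaj x q) ∧
    ∀ p : Fin n → ℝ, (∀ i, 0 ≤ p i) → (∀ q ∈ Q, WeakMaj p q) → WeakMaj p x

open Classical in
/-- The vector of eigenvalues of a Hermitian matrix, in decreasing order
(junk value `0` if the matrix is not Hermitian). -/
noncomputable def specVec {n : ℕ} (X : Matrix (Fin n) (Fin n) ℂ) : Fin n → ℝ :=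
  if h : X.IsHermitian then decrRearrange h.eigenvalues else 0

open Classical in
/-- `λ(|X|)`: the absolute values of the eigenvalues of a Hermitian matrix `X`,
in decreasing order. -/
noncomputable def absSpecVec {n : ℕ} (X : Matrix (Fin n) (Fin n) ℂ) : Fin n → ℝ :=
  if h : X.IsHermitian then decrRearrange (fun i => |h.eigenvalues i|) else 0

/-- The Jordan product `X ∘ Y = (XY + YX)/2`. -/
noncomputable def jmul {n : ℕ} (X Y : Matrix (Fin n) (Fin n) ℂ) : Matrix (Fin n) (Fin n) ℂ :=
  (2 : ℂ)⁻¹ • (X * Y + Y * X)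

/-- A nonzero (orthogonal) projection in `ℋⁿ`. -/
def IsProjection {n : ℕ} (P : Matrix (Fin n) (Fin n) ℂ) : Prop :=
  P.IsHermitian ∧ P * P = P ∧ P ≠ 0

/-- An involution in `ℋⁿ`: a Hermitian matrix with `ε² = I`. -/
def IsInvolution {n : ℕ} (ε : Matrix (Fin n) (Fin n) ℂ) : Prop :=
  ε.IsHermitian ∧ ε * ε = 1

/-- A positive map: maps positive semidefinite matrices to positive semidefinite matrices. -/
def PositiveMap {n : ℕ} (T : Matrix (Fin n) (Fin n) ℂ → Matrix (Fin n) (Fin n) ℂ) : Prop :=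
  ∀ X : Matrix (Fin n) (Fin n) ℂ, X.PosSemidef → (T X).PosSemidef

/-- `S` is the adjoint of `T` with respect to the trace inner product on `ℋⁿ`. -/
def IsAdjointOf {n : ℕ} (S T : Matrix (Fin n) (Fin n) ℂ → Matrix (Fin n) (Fin n) ℂ) : Prop :=
  ∀ X Y : Matrix (Fin n) (Fin n) ℂ, X.IsHermitian → Y.IsHermitian →
    Matrix.trace (T X * Y) = Matrix.trace (X * S Y)

/-- `q` is the least vector of `T`: `λ(|T(X)|) ≺_w q * λ(|X|)` for all Hermitian `X`,
and `q ≺_w q'` for any other `q' ∈ (ℝⁿ₊)↓` with the same property. -/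
def IsLeastVector {n : ℕ} (T : Matrix (Fin n) (Fin n) ℂ → Matrix (Fin n) (Fin n) ℂ)
    (q : Fin n → ℝ) : Prop :=
  DecrNonneg q ∧
  (∀ X : Matrix (Fin n) (Fin n) ℂ, X.IsHermitian →
    WeakMaj (absSpecVec (T X)) (q * absSpecVec X)) ∧
  ∀ q' : Fin n → ℝ, DecrNonneg q' →
    (∀ X : Matrix (Fin n) (Fin n) ℂ, X.IsHermitian →
      WeakMaj (absSpecVec (T X)) (q' * absSpecVec X)) → WeakMaj q q'

section SumLargest

variable {n : ℕ}

theorem bddAbove_sum_image_card (p : Fin n → ℝ) (k : ℕ) :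
    BddAbove ((fun A : Finset (Fin n) => ∑ i ∈ A, p i) '' {A : Finset (Fin n) | A.card = k}) :=
  (Set.toFinite _).bddAbove

theorem sum_le_sumLargest (p : Fin n → ℝ) {k : ℕ} {A : Finset (Fin n)} (hA : A.card = k) :
    ∑ i ∈ A, p i ≤ sumLargest p k :=
  le_csSup (bddAbove_sum_image_card p k) ⟨A, hA, rfl⟩

theorem exists_sum_eq_sumLargest (p : Fin n → ℝ) {k : ℕ} (hk : k ≤ n) :
    ∃ A : Finset (Fin n), A.card = k ∧ ∑ i ∈ A, p i = sumLargest p k := by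
  obtain ⟨B, -, hB⟩ := Finset.exists_subset_card_eq
    (s := (Finset.univ : Finset (Fin n))) (n := k) (by simpa using hk)
  obtain ⟨A, hA, hsum⟩ := Set.Nonempty.csSup_mem
    (s := (fun A : Finset (Fin n) => ∑ i ∈ A, p i) '' {A : Finset (Fin n) | A.card = k})
    ⟨_, B, hB, rfl⟩ (Set.toFinite _)
  exact ⟨A, hA, hsum⟩

theorem sumLargest_zero (p : Fin n → ℝ) : sumLargest p 0 = 0 := by
  obtain ⟨A, hA, hsum⟩ := exists_sum_eq_sumLargest p (Nat.zero_le n)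
  rw [← hsum, Finset.card_eq_zero.mp hA, Finset.sum_empty]

theorem sumLargest_nonneg {p : Fin n → ℝ} (hp : ∀ i, 0 ≤ p i) (k : ℕ) :
    0 ≤ sumLargest p k := by
  apply Real.sSup_nonneg
  rintro _ ⟨A, -, rfl⟩
  exact Finset.sum_nonneg fun i _ => hp i

theorem sumLargest_le_succ {p : Fin n → ℝ} (hp : ∀ i, 0 ≤ p i) {k : ℕ} (hk : k + 1 ≤ n) :
    sumLargest p k ≤ sumLargest p (k + 1) := by
  obtain ⟨A, hA, hsum⟩ := exists_sum_eq_sumLargest p (Nat.le_of_succ_le hk)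
  obtain ⟨x, hx⟩ : ∃ x, x ∉ A := by
    by_contra! h
    have := Finset.card_le_card (fun i _ => h i : Finset.univ ⊆ A)
    simp only [Finset.card_univ, Fintype.card_fin] at this
    omega
  have h := sum_le_sumLargest p (A := insert x A) (k := k + 1)
    (by rw [Finset.card_insert_of_notMem hx, hA])
  rw [Finset.sum_insert hx] at h
  linarith [hp x]

/-- Discrete concavity of `k ↦ sumLargest p k`, by moving one index of a maximizing
`(k + 2)`-set into a maximizing `k`-set. -/
theorem sumLargest_add_le (p : Fin n → ℝ) {k : ℕ} (hk : k + 2 ≤ n) :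
    sumLargest p k + sumLargest p (k + 2) ≤ 2 * sumLargest p (k + 1) := by
  obtain ⟨A, hA, hAsum⟩ := exists_sum_eq_sumLargest p (show k ≤ n by omega)
  obtain ⟨B, hB, hBsum⟩ := exists_sum_eq_sumLargest p hk
  obtain ⟨x, hxB, hxA⟩ := Finset.exists_mem_notMem_of_card_lt_card (show A.card < B.card by omega)
  have h₁ := sum_le_sumLargest p (A := insert x A) (k := k + 1)
    (by rw [Finset.card_insert_of_notMem hxA, hA])
  have h₂ := sum_le_sumLargest p (A := B.erase x) (k := k + 1)
    (by rw [Finset.card_erase_of_mem hxB, hB]; rfl)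
  rw [Finset.sum_insert hxA] at h₁
  have h₃ := Finset.add_sum_erase B p hxB
  linarith

theorem castLE_le_of_strictMono {k : ℕ} (hk : k ≤ n) {f : Fin k → Fin n} (hf : StrictMono f)
    (j : Fin k) : Fin.castLE hk j ≤ f j := by
  obtain ⟨j, hj⟩ := j
  induction j with
  | zero => exact Nat.zero_le _
  | succ j ih =>
    have h₁ : j ≤ (f ⟨j, by omega⟩ : ℕ) := ih (by omega)
    have h₂ : (f ⟨j, by omega⟩ : ℕ) < f ⟨j + 1, hj⟩ := hf (Nat.lt_succ_self j)
    exact Nat.succ_le_of_lt (h₁.trans_lt h₂)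

theorem sumLargest_eq_of_antitone {p : Fin n → ℝ} (hp : Antitone p) {k : ℕ} (hk : k ≤ n) :
    sumLargest p k = ∑ j : Fin k, p (Fin.castLE hk j) := by
  apply le_antisymm
  · obtain ⟨A, hA, hsum⟩ := exists_sum_eq_sumLargest p hk
    rw [← hsum, ← Finset.map_orderEmbOfFin_univ A hA, Finset.sum_map]
    exact Finset.sum_le_sum fun j _ =>
      hp (castLE_le_of_strictMono hk (A.orderEmbOfFin hA).strictMono j)
  · have h := sum_le_sumLargest p (k := k) (A := Finset.univ.map (Fin.castLEEmb hk)) (by simp)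
    rwa [Finset.sum_map] at h

theorem apply_eq_sumLargest_sub {p : Fin n → ℝ} (hp : Antitone p) (i : Fin n) :
    p i = sumLargest p (i + 1) - sumLargest p i := by
  rw [sumLargest_eq_of_antitone hp i.isLt, sumLargest_eq_of_antitone hp i.isLt.le,
    Fin.sum_univ_castSucc]
  exact (add_sub_cancel_left _ _).symm

theorem WeakMaj.eq_of_antitone {p q : Fin n → ℝ} (hp : Antitone p) (hq : Antitone q)
    (hpq : WeakMaj p q) (hqp : WeakMaj q p) : p = q := by
  have h : ∀ k ≤ n, sumLargest p k = sumLargest q k := by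
    intro k hk
    rcases Nat.eq_zero_or_pos k with rfl | h0
    · rw [sumLargest_zero, sumLargest_zero]
    · exact le_antisymm (hpq k h0 hk) (hqp k h0 hk)
  funext i
  rw [apply_eq_sumLargest_sub hp, apply_eq_sumLargest_sub hq, h _ i.isLt, h _ i.isLt.le]

/-- A nondecreasing concave sequence starting at `0` is the sequence of partial sums of a
decreasing nonnegative vector. -/
theorem exists_decrNonneg_sumLargest_eq {m : ℕ → ℝ} (h0 : m 0 = 0)
    (hmono : ∀ k, k + 1 ≤ n → m k ≤ m (k + 1))
    (hconc : ∀ k, k + 2 ≤ n → m k + m (k + 2) ≤ 2 * m (k + 1)) :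
    ∃ x : Fin n → ℝ, DecrNonneg x ∧ ∀ k ≤ n, sumLargest x k = m k := by
  have hanti : Antitone fun i : Fin n => m (i + 1) - m i := by
    rintro ⟨i, hi⟩ ⟨j, hj⟩ hij
    change i ≤ j at hij
    change m (j + 1) - m j ≤ m (i + 1) - m i
    induction j, hij using Nat.le_induction with
    | base => exact le_rfl
    | succ j _ ih => linarith [ih (by omega), hconc j (by omega)]
  refine ⟨_, ⟨hanti, fun i => sub_nonneg.mpr (hmono i i.isLt)⟩, fun k hk => ?_⟩
  rw [sumLargest_eq_of_antitone hanti hk]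
  have h := Fin.sum_univ_eq_sum_range (fun i => m (i + 1) - m i) k
  rw [Finset.sum_range_sub, h0, sub_zero] at h
  exact h

end SumLargest

theorem weak_majorization_inf_exists (n : ℕ) (hn : 1 ≤ n) (Q : Set (Fin n → ℝ))
    (hQne : Q.Nonempty) (hQpos : ∀ q ∈ Q, ∀ i, 0 ≤ q i) :
    ∃! qs : Fin n → ℝ, DecrNonneg qs ∧ (∀ q ∈ Q, WeakMaj qs q) ∧
      ∀ p : Fin n → ℝ, (∀ i, 0 ≤ p i) → (∀ q ∈ Q, WeakMaj p q) → WeakMaj p qs := by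
  have : Nonempty Q := hQne.to_subtype
  set m : ℕ → ℝ := fun k => ⨅ q : Q, sumLargest q.1 k with hm
  have hle : ∀ q ∈ Q, ∀ k, m k ≤ sumLargest q k := fun q hq k =>
    ciInf_le ⟨0, by rintro _ ⟨r, rfl⟩; exact sumLargest_nonneg (hQpos r r.2) k⟩ (⟨q, hq⟩ : Q)
  have hge : ∀ k c, (∀ q ∈ Q, c ≤ sumLargest q k) → c ≤ m k := fun k c h =>
    le_ciInf fun q => h q q.2
  obtain ⟨x, hx, hxm⟩ := exists_decrNonneg_sumLargest_eq (n := n) (m := m)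
    (by simp [hm, sumLargest_zero])
    (fun k hk => hge _ _ fun q hq => (hle q hq k).trans (sumLargest_le_succ (hQpos q hq) hk))
    (fun k hk => by
      have h : (m k + m (k + 2)) / 2 ≤ m (k + 1) := hge _ _ fun q hq => by
        linarith [hle q hq k, hle q hq (k + 2), sumLargest_add_le q hk]
      linarith)
  have hlower : ∀ q ∈ Q, WeakMaj x q := fun q hq k _ hk => (hxm k hk).trans_le (hle q hq k)
  refine ⟨x, ⟨hx, hlower, fun p _ hpQ k h1 hk => ?_⟩, fun y ⟨hy, hyQ, hyx⟩ => ?_⟩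
  · rw [hxm k hk]
    exact hge _ _ fun q hq => hpQ q hq k h1 hk
  · refine WeakMaj.eq_of_antitone hy.1 hx.1 (fun k h1 hk => ?_) (hyx x hx.2 hlower)
    rw [hxm k hk]
    exact hge _ _ fun q hq => hyQ q hq k h1 hk
end

section
/- Let T : ℋⁿ → ℋⁿ be an ℝ-linear map. Then there exists a unique q ∈ (ℝⁿ₊)↓ such that λ(|T(X)|) ≺_w q*λ(|X|) for all X ∈ ℋⁿ, with the additional property that q ≺_w q′ for every q′ ∈ (ℝⁿ₊)↓ satisfying λ(|T(X)|) ≺_w q′*λ(|X|) for all X ∈ ℋⁿ. -/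
open Matrix
open scoped ComplexOrder

/-- The sum of the first `k` entries of `p`. -/
def prefixSum {n : ℕ} (p : Fin n → ℝ) (k : ℕ) : ℝ :=
  ∑ i, if i.val < k then p i else 0

lemma DecrNonneg.mul {n : ℕ} {p q : Fin n → ℝ} (hp : DecrNonneg p) (hq : DecrNonneg q) :
    DecrNonneg (p * q) :=
  ⟨fun i j h => mul_le_mul (hp.1 h) (hq.1 h) (hq.2 j) (hp.2 i),
    fun i => mul_nonneg (hp.2 i) (hq.2 i)⟩

lemma sum_ite_val_lt_one {n m : ℕ} (h : m ≤ n) :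
    ∑ i : Fin n, (if i.val < m then (1 : ℝ) else 0) = m := by
  rw [Fin.sum_univ_eq_sum_range (fun i => if i < m then (1 : ℝ) else 0) n]
  rw [← Finset.sum_filter, Finset.sum_const, nsmul_one]
  congr 1
  have : (Finset.range n).filter (fun i => i < m) = Finset.range m := by
    ext i; simp; omega
  rw [this, Finset.card_range]

/-- A `[0,1]`-weighting of total mass at most `m` cannot beat the first `m` entries. -/
lemma sum_mul_le_prefixSum {n : ℕ} {p : Fin n → ℝ} (hp : DecrNonneg p) {c : Fin n → ℝ}
    (h0 : ∀ i, 0 ≤ c i) (h1 : ∀ i, c i ≤ 1) {m : ℕ} (hm : ∑ i, c i ≤ m) :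
    ∑ i, p i * c i ≤ prefixSum p m := by
  unfold prefixSum
  rcases lt_or_ge m n with h | h
  · have key : ∀ i : Fin n, (p i - p ⟨m, h⟩) * c i ≤
        (if i.val < m then p i else 0) - p ⟨m, h⟩ * (if i.val < m then 1 else 0) := by
      intro i
      split_ifs with hi
      · have := hp.1 (show i ≤ ⟨m, h⟩ from hi.le)
        nlinarith [h1 i]
      · have := hp.1 (show (⟨m, h⟩ : Fin n) ≤ i from not_lt.mp hi)
        nlinarith [h0 i]
    have := Finset.sum_le_sum fun i (_ : i ∈ Finset.univ) => key i
    simp only [sub_mul, Finset.sum_sub_distrib, ← Finset.mul_sum] at this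
    rw [sum_ite_val_lt_one h.le] at this
    nlinarith [mul_le_mul_of_nonneg_left hm (hp.2 ⟨m, h⟩)]
  · refine Finset.sum_le_sum fun i _ => ?_
    rw [if_pos (by omega)]
    exact mul_le_of_le_one_right (hp.2 i) (h1 i)

lemma sum_indicator_one {n : ℕ} (A : Finset (Fin n)) :
    ∑ i, (if i ∈ A then (1 : ℝ) else 0) = A.card := by
  simp

lemma sumLargest_eq_prefixSum {n : ℕ} {p : Fin n → ℝ} (hp : DecrNonneg p) {k : ℕ} (hk : k ≤ n) :
    sumLargest p k = prefixSum p k := by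
  have hub : ∀ x ∈ (fun A : Finset (Fin n) => ∑ i ∈ A, p i) '' {A : Finset (Fin n) | A.card = k},
      x ≤ prefixSum p k := by
    rintro _ ⟨A, hA, rfl⟩
    have := sum_mul_le_prefixSum hp (c := fun i => if i ∈ A then 1 else 0) (m := k)
      (fun i => by positivity) (fun i => by split_ifs <;> norm_num)
      (by rw [sum_indicator_one, hA])
    simpa using this
  have hmem : prefixSum p k ∈
      (fun A : Finset (Fin n) => ∑ i ∈ A, p i) '' {A : Finset (Fin n) | A.card = k} := by
    refine ⟨Finset.univ.filter fun i => i.val < k, ?_, ?_⟩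
    · have h := sum_ite_val_lt_one hk
      rw [← Finset.sum_filter, Finset.sum_const, nsmul_one] at h
      exact_mod_cast h
    · simp [prefixSum, Finset.sum_filter]
  exact le_antisymm (csSup_le ⟨_, hmem⟩ hub) (le_csSup ⟨_, hub⟩ hmem)

lemma weakMaj_iff_prefixSum {n : ℕ} {p q : Fin n → ℝ} (hp : DecrNonneg p) (hq : DecrNonneg q) :
    WeakMaj p q ↔ ∀ k, 1 ≤ k → k ≤ n → prefixSum p k ≤ prefixSum q k := by
  refine forall_congr' fun k => forall_congr' fun _ => forall_congr' fun hk => ?_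
  rw [sumLargest_eq_prefixSum hp hk, sumLargest_eq_prefixSum hq hk]

lemma prefixSum_zero {n : ℕ} (p : Fin n → ℝ) : prefixSum p 0 = 0 := by
  simp [prefixSum]

lemma prefixSum_succ {n : ℕ} (p : Fin n → ℝ) (i : Fin n) :
    prefixSum p (i + 1) = prefixSum p i + p i := by
  unfold prefixSum
  have h : p i = ∑ j, if j = i then p j else 0 := by simp
  rw [h, ← Finset.sum_add_distrib]
  refine Finset.sum_congr rfl fun j _ => ?_
  by_cases hj : j = i
  · subst hj; simp
  · have : (j : ℕ) ≠ i := fun h => hj (Fin.ext h)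
    by_cases hl : (j : ℕ) < i
    · rw [if_pos (by omega), if_pos hl, if_neg hj, add_zero]
    · rw [if_neg (by omega), if_neg hl, if_neg hj, add_zero]

lemma eq_of_weakMaj_weakMaj {n : ℕ} {p q : Fin n → ℝ} (hp : DecrNonneg p) (hq : DecrNonneg q)
    (h : WeakMaj p q) (h' : WeakMaj q p) : p = q := by
  rw [weakMaj_iff_prefixSum hp hq] at h
  rw [weakMaj_iff_prefixSum hq hp] at h'
  have key : ∀ k ≤ n, prefixSum p k = prefixSum q k := by
    intro k hk
    rcases Nat.eq_zero_or_pos k with rfl | h0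
    · rw [prefixSum_zero, prefixSum_zero]
    · exact le_antisymm (h k h0 hk) (h' k h0 hk)
  funext i
  have h1 := prefixSum_succ p i
  have h2 := prefixSum_succ q i
  rw [key _ i.2, key _ i.2.le] at h1
  linarith

lemma prefixSum_nonneg {n : ℕ} {p : Fin n → ℝ} (hp : DecrNonneg p) (k : ℕ) :
    0 ≤ prefixSum p k :=
  Finset.sum_nonneg fun i _ => by
    have := hp.2 i
    split_ifs <;> simp [this]

lemma prefixSum_of_sub {n : ℕ} (f : ℕ → ℝ) (h0 : f 0 = 0) {k : ℕ} (hk : k ≤ n) :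
    prefixSum (fun i : Fin n => f (i + 1) - f i) k = f k := by
  induction k with
  | zero => rw [prefixSum_zero, h0]
  | succ k ih =>
    have := prefixSum_succ (fun i : Fin n => f (i + 1) - f i) ⟨k, hk⟩
    simp only at this
    rw [this, ih (by omega)]
    ring

/-- Every nonempty set of decreasing nonnegative vectors has a decreasing nonnegative vector whose
prefix sums are the infima of the prefix sums. -/
lemma exists_isGLB_prefixSum {n : ℕ} {F : Set (Fin n → ℝ)} (hF : F.Nonempty)
    (hdec : ∀ p ∈ F, DecrNonneg p) :
    ∃ q : Fin n → ℝ, DecrNonneg q ∧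
      ∀ k ≤ n, IsGLB ((fun p => prefixSum p k) '' F) (prefixSum q k) := by
  set f : ℕ → ℝ := fun k => sInf ((fun p => prefixSum p k) '' F) with hf
  have hglb : ∀ k, IsGLB ((fun p => prefixSum p k) '' F) (f k) := fun k =>
    isGLB_csInf (hF.image _) ⟨0, by rintro _ ⟨p, hp, rfl⟩; exact prefixSum_nonneg (hdec p hp) k⟩
  have hle : ∀ k, ∀ p ∈ F, f k ≤ prefixSum p k := fun k p hp => (hglb k).1 ⟨p, hp, rfl⟩
  have hge : ∀ k b, (∀ p ∈ F, b ≤ prefixSum p k) → b ≤ f k := fun k b hb =>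
    (hglb k).2 (by rintro _ ⟨p, hp, rfl⟩; exact hb p hp)
  have h0 : f 0 = 0 := by
    obtain ⟨p, hp⟩ := hF
    refine le_antisymm ?_ (hge _ _ fun p _ => (prefixSum_zero p).ge)
    simpa [prefixSum_zero] using hle 0 p hp
  have hanti : ∀ k, ∀ h : k + 1 < n, f (k + 2) - f (k + 1) ≤ f (k + 1) - f k := by
    intro k h
    have : (f (k + 2) + f k) / 2 ≤ f (k + 1) := by
      refine hge _ _ fun p hp => ?_
      have a1 := prefixSum_succ p ⟨k, by omega⟩
      have a2 := prefixSum_succ p ⟨k + 1, h⟩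
      have a3 := (hdec p hp).1 (show (⟨k, by omega⟩ : Fin n) ≤ ⟨k + 1, h⟩ by simp)
      have a4 := hle (k + 2) p hp
      have a5 := hle k p hp
      simp only at a1 a2
      linarith
    linarith
  refine ⟨fun i => f (i + 1) - f i, ⟨?_, fun i => ?_⟩, fun k hk => ?_⟩
  · have step : ∀ a b : ℕ, a ≤ b → b < n → f (b + 1) - f b ≤ f (a + 1) - f a := by
      intro a b hab
      induction b, hab using Nat.le_induction with
      | base => exact fun _ => le_rfl
      | succ b _ ih => exact fun hb => (hanti b hb).trans (ih (by omega))
    exact fun a b hab => step a b hab b.2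
  · refine sub_nonneg.mpr (hge _ _ fun p hp => ?_)
    have := prefixSum_succ p i
    have := (hdec p hp).2 i
    have := hle i p hp
    linarith
  · rw [prefixSum_of_sub f h0 hk]
    exact hglb k

lemma decrRearrange_antitone {n : ℕ} (p : Fin n → ℝ) : Antitone (decrRearrange p) :=
  fun _ _ h => Tuple.monotone_sort p (Fin.rev_le_rev.mpr h)

lemma decrNonneg_absSpecVec {n : ℕ} (X : Matrix (Fin n) (Fin n) ℂ) :
    DecrNonneg (absSpecVec X) := by
  unfold absSpecVec
  split_ifs with h
  · exact ⟨decrRearrange_antitone _, fun i => abs_nonneg _⟩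
  · exact ⟨antitone_const, fun _ => le_rfl⟩

/-- The matrix `U diag(d) U*`. -/
def conjDiag {n : ℕ} (U : Matrix (Fin n) (Fin n) ℂ) (d : Fin n → ℝ) : Matrix (Fin n) (Fin n) ℂ :=
  U * diagonal (fun i => (d i : ℂ)) * Uᴴ

lemma isHermitian_conjDiag {n : ℕ} (U : Matrix (Fin n) (Fin n) ℂ) (d : Fin n → ℝ) :
    (conjDiag U d).IsHermitian := by
  refine isHermitian_mul_mul_conjTranspose U (isHermitian_diagonal_of_self_adjoint _ ?_)
  ext i; simp

lemma conjDiag_apply {n : ℕ} (U : Matrix (Fin n) (Fin n) ℂ) (d : Fin n → ℝ) (a b : Fin n) :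
    conjDiag U d a b = ∑ l, U a l * (d l : ℂ) * star (U b l) := by
  rw [conjDiag, mul_apply]
  simp [mul_diagonal]

/-- The `i`-th diagonal entry of `V* Y V`. -/
def diagEntry {n : ℕ} (V : Matrix (Fin n) (Fin n) ℂ) (i : Fin n) (Y : Matrix (Fin n) (Fin n) ℂ) :
    ℝ :=
  ((Vᴴ * Y * V) i i).re

lemma diagEntry_sum_smul {n : ℕ} (V : Matrix (Fin n) (Fin n) ℂ) (i : Fin n) {ι : Type*}
    (s : Finset ι) (t : ι → ℝ) (Y : ι → Matrix (Fin n) (Fin n) ℂ) :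
    diagEntry V i (∑ j ∈ s, t j • Y j) = ∑ j ∈ s, t j * diagEntry V i (Y j) := by
  simp [diagEntry, Finset.mul_sum, Finset.sum_mul, Matrix.sum_apply]

lemma diagEntry_conjDiag {n : ℕ} (U V : Matrix (Fin n) (Fin n) ℂ) (d : Fin n → ℝ) (i : Fin n) :
    diagEntry V i (conjDiag U d) = ∑ l, Complex.normSq ((Vᴴ * U) i l) * d l := by
  have h : Vᴴ * conjDiag U d * V = conjDiag (Vᴴ * U) d := by
    simp [conjDiag, Matrix.mul_assoc]
  rw [diagEntry, h, conjDiag_apply, Complex.re_sum]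
  refine Finset.sum_congr rfl fun l _ => ?_
  simp [Complex.normSq_apply]
  ring

lemma abs_diagEntry_conjDiag_le {n : ℕ} (U V : Matrix (Fin n) (Fin n) ℂ) {d e : Fin n → ℝ}
    (h : ∀ l, |d l| ≤ e l) (i : Fin n) :
    |diagEntry V i (conjDiag U d)| ≤ ∑ l, Complex.normSq ((Vᴴ * U) i l) * e l := by
  rw [diagEntry_conjDiag]
  refine (Finset.abs_sum_le_sum_abs _ _).trans (Finset.sum_le_sum fun l _ => ?_)
  rw [abs_mul, abs_of_nonneg (Complex.normSq_nonneg _)]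
  exact mul_le_mul_of_nonneg_left (h l) (Complex.normSq_nonneg _)

lemma sum_normSq_row {n : ℕ} {W : Matrix (Fin n) (Fin n) ℂ} (hW : W ∈ unitaryGroup (Fin n) ℂ)
    (i : Fin n) : ∑ l, Complex.normSq (W i l) = 1 := by
  have h := congrFun (congrFun (mem_unitaryGroup_iff.mp hW) i) i
  rw [mul_apply, one_apply_eq] at h
  have h2 := congrArg Complex.re h
  rw [Complex.re_sum, Complex.one_re] at h2
  rw [← h2]
  exact Finset.sum_congr rfl fun l _ => by
    simp [Complex.normSq_apply, star_apply]

lemma sum_normSq_col {n : ℕ} {W : Matrix (Fin n) (Fin n) ℂ} (hW : W ∈ unitaryGroup (Fin n) ℂ)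
    (l : Fin n) : ∑ i, Complex.normSq (W i l) = 1 := by
  have h := sum_normSq_row (Unitary.star_mem hW) l
  simpa [star_apply] using h

lemma conjTranspose_mul_mem_unitaryGroup {n : ℕ} {U V : Matrix (Fin n) (Fin n) ℂ}
    (hU : U ∈ unitaryGroup (Fin n) ℂ) (hV : V ∈ unitaryGroup (Fin n) ℂ) :
    Vᴴ * U ∈ unitaryGroup (Fin n) ℂ :=
  mul_mem (Unitary.star_mem hV) hU

/-- Spectral decomposition with the absolute eigenvalues in decreasing order. -/
lemma exists_conjDiag_absSpecVec {n : ℕ} {Y : Matrix (Fin n) (Fin n) ℂ} (hY : Y.IsHermitian) :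
    ∃ V ∈ unitaryGroup (Fin n) ℂ, ∃ s : Fin n → ℝ, (∀ i, |s i| = 1) ∧
      Y = conjDiag V (s * absSpecVec Y) := by
  set p : Fin n → ℝ := fun i => |hY.eigenvalues i|
  set σ : Equiv.Perm (Fin n) := Fin.revPerm.trans (Tuple.sort p) with hσ
  have hx : absSpecVec Y = fun i => p (σ i) := by
    rw [absSpecVec, dif_pos hY]; rfl
  set U : Matrix (Fin n) (Fin n) ℂ := (hY.eigenvectorUnitary).1 with hU
  have hUm : U ∈ unitaryGroup (Fin n) ℂ := hY.eigenvectorUnitary.2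
  have hs : ∀ r : ℝ, ∃ s : ℝ, |s| = 1 ∧ s * |r| = r := by
    intro r
    rcases le_total 0 r with h | h
    · exact ⟨1, by simp, by rw [abs_of_nonneg h, one_mul]⟩
    · exact ⟨-1, by simp, by rw [abs_of_nonpos h]; ring⟩
  choose s hs1 hs2 using fun i => hs (hY.eigenvalues (σ i))
  refine ⟨U.submatrix id σ, ?_, s, hs1, ?_⟩
  · rw [mem_unitaryGroup_iff] at hUm ⊢
    ext a b
    have := congrFun (congrFun hUm a) b
    rw [← this, mul_apply, mul_apply]
    exact Equiv.sum_comp σ fun l => U a l * star U l b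
  · have hsp := hY.spectral_theorem
    rw [Unitary.conjStarAlgAut_apply] at hsp
    ext a b
    have h1 : Y = conjDiag U hY.eigenvalues := hsp
    rw [congrFun (congrFun h1 a) b, conjDiag_apply, conjDiag_apply, hx,
      ← Equiv.sum_comp σ]
    refine Finset.sum_congr rfl fun l _ => ?_
    have : (s * fun i => p (σ i)) l = hY.eigenvalues (σ l) := hs2 l
    rw [this]; rfl

lemma diagEntry_conjDiag_self {n : ℕ} {V : Matrix (Fin n) (Fin n) ℂ}
    (hV : V ∈ unitaryGroup (Fin n) ℂ) (d : Fin n → ℝ) (i : Fin n) :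
    diagEntry V i (conjDiag V d) = d i := by
  have h : Vᴴ * V = 1 := mem_unitaryGroup_iff'.mp hV
  rw [diagEntry_conjDiag, h, Finset.sum_eq_single i]
  · simp
  · intro l _ hl
    simp [one_apply_ne hl.symm]
  · simp

/-- The Ky Fan inequality for diagonal entries in an orthonormal basis. -/
lemma prefixSum_abs_diagEntry_le {n : ℕ} {Y : Matrix (Fin n) (Fin n) ℂ} (hY : Y.IsHermitian)
    {V : Matrix (Fin n) (Fin n) ℂ} (hV : V ∈ unitaryGroup (Fin n) ℂ) {k : ℕ} (hk : k ≤ n) :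
    prefixSum (fun i => |diagEntry V i Y|) k ≤ prefixSum (absSpecVec Y) k := by
  obtain ⟨U, hU, s, hs, hYU⟩ := exists_conjDiag_absSpecVec hY
  have hx := decrNonneg_absSpecVec Y
  set x := absSpecVec Y
  have hW := conjTranspose_mul_mem_unitaryGroup hU hV
  have hent : ∀ i, |diagEntry V i Y| ≤ ∑ l, Complex.normSq ((Vᴴ * U) i l) * x l := fun i => by
    rw [hYU]
    exact abs_diagEntry_conjDiag_le U V
      (fun l => by rw [Pi.mul_apply, abs_mul, hs, one_mul, abs_of_nonneg (hx.2 l)]) i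
  have hc1 : ∀ l, ∑ i : Fin n, (if i.val < k then Complex.normSq ((Vᴴ * U) i l) else 0) ≤ 1 :=
    fun l => by
      rw [← sum_normSq_col hW l]
      exact Finset.sum_le_sum fun i _ => by
        have := Complex.normSq_nonneg ((Vᴴ * U) i l)
        split_ifs <;> simp [this]
  refine le_trans ?_ (sum_mul_le_prefixSum hx
    (c := fun l => ∑ i : Fin n, if i.val < k then Complex.normSq ((Vᴴ * U) i l) else 0)
    (fun l => Finset.sum_nonneg fun i _ => by
      have := Complex.normSq_nonneg ((Vᴴ * U) i l)
      split_ifs <;> simp [this]) hc1 ?_)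
  · simp only [Finset.mul_sum]
    rw [Finset.sum_comm]
    refine Finset.sum_le_sum fun i _ => ?_
    split_ifs with hi
    · exact (hent i).trans (Finset.sum_le_sum fun l _ => (mul_comm _ _).le)
    · simp
  · rw [Finset.sum_comm, ← sum_ite_val_lt_one hk]
    refine Finset.sum_le_sum fun i _ => ?_
    split_ifs with hi
    · exact (sum_normSq_row hW i).le
    · simp

/-- Weighted prefix sums of a Hermitian contraction of rank at most `j`. -/
lemma prefixSum_mul_absSpecVec_conjDiag_le {n : ℕ} {U : Matrix (Fin n) (Fin n) ℂ}
    (hU : U ∈ unitaryGroup (Fin n) ℂ) {d : Fin n → ℝ} {j : ℕ} (hj : j ≤ n)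
    (hd : ∀ l, |d l| ≤ if l.val < j then 1 else 0) {q : Fin n → ℝ} (hq : DecrNonneg q)
    {k : ℕ} (hk : k ≤ n) :
    prefixSum (q * absSpecVec (conjDiag U d)) k ≤ prefixSum q (min k j) := by
  obtain ⟨V, hV, s, hs, hVE⟩ := exists_conjDiag_absSpecVec (isHermitian_conjDiag U d)
  have ha := decrNonneg_absSpecVec (conjDiag U d)
  have hW := conjTranspose_mul_mem_unitaryGroup hU hV
  have hent : ∀ i, absSpecVec (conjDiag U d) i ≤
      ∑ l : Fin n, Complex.normSq ((Vᴴ * U) i l) * (if l.val < j then 1 else 0) := fun i => by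
    have h := abs_diagEntry_conjDiag_le U V hd i
    rw [hVE, diagEntry_conjDiag_self hV, Pi.mul_apply, abs_mul, hs, one_mul,
      abs_of_nonneg (ha.2 i)] at h
    exact h
  set a := absSpecVec (conjDiag U d)
  have ha1 : ∀ i, a i ≤ 1 := fun i => (hent i).trans <| by
    refine le_of_le_of_eq ?_ (sum_normSq_row hW i)
    refine Finset.sum_le_sum fun l _ => mul_le_of_le_one_right (Complex.normSq_nonneg _) ?_
    split_ifs
    exacts [le_rfl, zero_le_one]
  have hasum : ∑ i, a i ≤ j := (Finset.sum_le_sum fun i _ => hent i).trans <| by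
    rw [Finset.sum_comm, ← sum_ite_val_lt_one hj]
    refine Finset.sum_le_sum fun l _ => ?_
    rw [← Finset.sum_mul, sum_normSq_col hW l, one_mul]
  have := sum_mul_le_prefixSum hq (c := fun i => if i.val < k then a i else 0) (m := min k j)
    (fun i => by have := ha.2 i; split_ifs <;> simp [this])
    (fun i => by have := ha1 i; split_ifs <;> simp [this]) ?_
  · refine le_trans (Finset.sum_le_sum fun i _ => ?_) this
    split_ifs <;> simp
  · rw [Nat.cast_min]
    refine le_min ?_ ?_
    · rw [← sum_ite_val_lt_one hk]
      exact Finset.sum_le_sum fun i _ => by have := ha1 i; split_ifs <;> simp [this]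
    · exact (Finset.sum_le_sum fun i _ => by
        have := ha.2 i; split_ifs <;> simp [this]).trans hasum

/-- A decreasing nonnegative vector is a nonnegative combination of indicators of initial
segments. -/
lemma exists_eq_sum_indicator {n : ℕ} {x : Fin n → ℝ} (hx : DecrNonneg x) :
    ∃ t : Fin n → ℝ, (∀ j, 0 ≤ t j) ∧
      ∀ i : Fin n, x i = ∑ j : Fin n, t j * if i.val < j.val + 1 then 1 else 0 := by
  set y : ℕ → ℝ := fun i => if h : i < n then x ⟨i, h⟩ else 0 with hy
  have hyx : ∀ i : Fin n, y i = x i := fun i => by simp [hy]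
  have hyn : y n = 0 := by simp [hy]
  refine ⟨fun j => y j - y (j + 1), fun j => ?_, fun i => ?_⟩
  · simp only [hyx]
    simp only [hy]
    split_ifs with h
    · exact sub_nonneg.mpr (hx.1 (by simp [Fin.le_def]))
    · simpa using hx.2 j
  · rw [Fin.sum_univ_eq_sum_range
      (fun j => (y j - y (j + 1)) * if i.val < j + 1 then 1 else 0) n]
    have key : ∀ m, i.val ≤ m → ∑ j ∈ Finset.range m,
        (y j - y (j + 1)) * (if i.val < j + 1 then 1 else 0) = y i - y m := by
      intro m hm
      induction m, hm using Nat.le_induction with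
      | base =>
        rw [sub_self]
        refine Finset.sum_eq_zero fun j hj => ?_
        rw [if_neg (by have := Finset.mem_range.mp hj; omega), mul_zero]
      | succ m hm ih => rw [Finset.sum_range_succ, ih, if_pos (by omega)]; ring
    rw [key n i.2.le, hyn, hyx, sub_zero]

/-- It suffices to check the defining inequality on sign combinations of spectral projections. -/
lemma weakMaj_absSpecVec_map_of_conjDiag {n : ℕ}
    {T : Matrix (Fin n) (Fin n) ℂ → Matrix (Fin n) (Fin n) ℂ} (hTlin : IsLinearMap ℝ T)
    (hT : ∀ X : Matrix (Fin n) (Fin n) ℂ, X.IsHermitian → (T X).IsHermitian)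
    {q : Fin n → ℝ} (hq : DecrNonneg q)
    (h : ∀ U ∈ unitaryGroup (Fin n) ℂ, ∀ (d : Fin n → ℝ) (j k : ℕ), 1 ≤ j → j ≤ n → 1 ≤ k →
      k ≤ n → (∀ l, |d l| ≤ if l.val < j then 1 else 0) →
      prefixSum (absSpecVec (T (conjDiag U d))) k ≤ prefixSum q (min k j))
    {X : Matrix (Fin n) (Fin n) ℂ} (hX : X.IsHermitian) :
    WeakMaj (absSpecVec (T X)) (q * absSpecVec X) := by
  have hx := decrNonneg_absSpecVec X
  have hy := decrNonneg_absSpecVec (T X)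
  rw [weakMaj_iff_prefixSum hy (hq.mul hx)]
  intro k hk1 hk
  obtain ⟨V, hV, r, hr, hTX⟩ := exists_conjDiag_absSpecVec (hT X hX)
  obtain ⟨U, hU, s, hs, hXU⟩ := exists_conjDiag_absSpecVec hX
  obtain ⟨t, ht, hxt⟩ := exists_eq_sum_indicator hx
  set y := absSpecVec (T X)
  set x := absSpecVec X
  set d : Fin n → Fin n → ℝ := fun j i => s i * if i.val < j.val + 1 then 1 else 0 with hd
  have hXsum : X = ∑ j, t j • conjDiag U (d j) := by
    conv_lhs => rw [hXU]
    ext a b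
    simp only [Matrix.sum_apply, Matrix.smul_apply, conjDiag_apply, Finset.smul_sum]
    rw [Finset.sum_comm]
    refine Finset.sum_congr rfl fun l _ => ?_
    have : (s * x) l = ∑ j, t j * d j l := by
      rw [Pi.mul_apply, hxt l, Finset.mul_sum]
      exact Finset.sum_congr rfl fun j _ => by simp only [hd]; ring
    rw [this, Complex.ofReal_sum, Finset.mul_sum, Finset.sum_mul]
    refine Finset.sum_congr rfl fun j _ => ?_
    rw [Complex.real_smul]; push_cast; ring
  have hTsum : T X = ∑ j, t j • T (conjDiag U (d j)) := by
    have h1 := map_sum hTlin.mk' (fun j => t j • conjDiag U (d j)) Finset.univ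
    simp only [map_smul] at h1
    conv_lhs => rw [hXsum]
    exact h1
  have hyle : ∀ i, y i ≤ ∑ j, t j * |diagEntry V i (T (conjDiag U (d j)))| := fun i => by
    have h1 : |diagEntry V i (T X)| = y i := by
      rw [hTX, diagEntry_conjDiag_self hV, Pi.mul_apply, abs_mul, hr, one_mul,
        abs_of_nonneg (hy.2 i)]
    rw [← h1, hTsum, diagEntry_sum_smul]
    refine (Finset.abs_sum_le_sum_abs _ _).trans (Finset.sum_le_sum fun j _ => ?_)
    rw [abs_mul, abs_of_nonneg (ht j)]
  calc prefixSum y k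
      ≤ ∑ i : Fin n, if i.val < k then
          ∑ j, t j * |diagEntry V i (T (conjDiag U (d j)))| else 0 :=
        Finset.sum_le_sum fun i _ => by have := hyle i; split_ifs <;> simp [this]
    _ = ∑ j, t j * prefixSum (fun i => |diagEntry V i (T (conjDiag U (d j)))|) k := by
        simp only [prefixSum, Finset.mul_sum]
        rw [Finset.sum_comm]
        refine Finset.sum_congr rfl fun i _ => ?_
        split_ifs <;> simp
    _ ≤ ∑ j : Fin n, t j * prefixSum q (min k (j.val + 1)) := by
        refine Finset.sum_le_sum fun j _ => mul_le_mul_of_nonneg_left ?_ (ht j)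
        refine (prefixSum_abs_diagEntry_le (hT _ (isHermitian_conjDiag U (d j))) hV hk).trans
          (h U hU (d j) (j.val + 1) k (by omega) j.2 hk1 hk fun l => ?_)
        simp only [hd]
        rw [abs_mul, hs, one_mul]
        split_ifs <;> simp
    _ = prefixSum (q * x) k := by
        simp only [prefixSum, Finset.mul_sum, Pi.mul_apply]
        rw [Finset.sum_comm]
        refine Finset.sum_congr rfl fun i _ => ?_
        by_cases hi : i.val < k
        · rw [if_pos hi, hxt i, Finset.mul_sum]
          refine Finset.sum_congr rfl fun j _ => ?_
          simp only [lt_min_iff, hi, true_and]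
          split_ifs <;> ring
        · simp [hi]

lemma exists_entry_bound {n : ℕ} {T : Matrix (Fin n) (Fin n) ℂ → Matrix (Fin n) (Fin n) ℂ}
    (hTlin : IsLinearMap ℝ T) :
    ∃ C : ℝ, 0 ≤ C ∧ ∀ (X : Matrix (Fin n) (Fin n) ℂ) (M : ℝ), 0 ≤ M → (∀ a b, ‖X a b‖ ≤ M) →
      ∀ a b, ‖T X a b‖ ≤ C * M := by
  let L := LinearMap.toContinuousLinearMap
    ((ofLinearEquiv ℝ).symm.toLinearMap ∘ₗ hTlin.mk' ∘ₗ
      (ofLinearEquiv ℝ : (Fin n → Fin n → ℂ) ≃ₗ[ℝ] Matrix (Fin n) (Fin n) ℂ).toLinearMap)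
  refine ⟨‖L‖, norm_nonneg _, fun X M hM hX a b => ?_⟩
  have hXM : ‖(fun a b => X a b : Fin n → Fin n → ℂ)‖ ≤ M :=
    (pi_norm_le_iff_of_nonneg hM).mpr fun a => (pi_norm_le_iff_of_nonneg hM).mpr (hX a)
  calc ‖T X a b‖ ≤ ‖L (fun a b => X a b)‖ :=
        (norm_le_pi_norm (L (fun a b => X a b) a) b).trans (norm_le_pi_norm _ a)
    _ ≤ ‖L‖ * ‖(fun a b => X a b : Fin n → Fin n → ℂ)‖ := L.le_opNorm _
    _ ≤ ‖L‖ * M := mul_le_mul_of_nonneg_left hXM (norm_nonneg _)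

lemma absSpecVec_le_of_entry_bound {n : ℕ} {Y : Matrix (Fin n) (Fin n) ℂ} (hY : Y.IsHermitian)
    {M : ℝ} (h : ∀ a b, ‖Y a b‖ ≤ M) (i : Fin n) : absSpecVec Y i ≤ n * n * M := by
  obtain ⟨V, hV, s, hs, hYV⟩ := exists_conjDiag_absSpecVec hY
  have h1 : |diagEntry V i Y| = absSpecVec Y i := by
    conv_lhs => rw [hYV]
    rw [diagEntry_conjDiag_self hV, Pi.mul_apply, abs_mul, hs, one_mul,
      abs_of_nonneg ((decrNonneg_absSpecVec Y).2 i)]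
  have hV1 := entry_norm_bound_of_unitary hV
  rw [← h1, diagEntry]
  refine (Complex.abs_re_le_norm _).trans ?_
  simp only [mul_apply, Finset.sum_mul]
  calc _ ≤ ∑ _b : Fin n, ∑ _a : Fin n, M := by
        refine norm_sum_le_of_le _ fun b _ => norm_sum_le_of_le _ fun a _ => ?_
        rw [norm_mul, norm_mul, conjTranspose_apply, norm_star]
        have h2 : ‖V a i‖ * ‖Y a b‖ ≤ M :=
          (mul_le_of_le_one_left (norm_nonneg _) (hV1 _ _)).trans (h a b)
        exact (mul_le_of_le_one_right (by positivity) (hV1 _ _)).trans h2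
    _ = n * n * M := by simp [mul_assoc]

lemma norm_conjDiag_apply_le {n : ℕ} {U : Matrix (Fin n) (Fin n) ℂ}
    (hU : U ∈ unitaryGroup (Fin n) ℂ) {d : Fin n → ℝ} (hd : ∀ l, |d l| ≤ 1) (a b : Fin n) :
    ‖conjDiag U d a b‖ ≤ n := by
  have hU1 := entry_norm_bound_of_unitary hU
  rw [conjDiag_apply]
  calc _ ≤ ∑ _l : Fin n, (1 : ℝ) := by
        refine norm_sum_le_of_le _ fun l _ => ?_
        rw [norm_mul, norm_mul, norm_star, Complex.norm_real, Real.norm_eq_abs]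
        exact mul_le_one₀ (mul_le_one₀ (hU1 _ _) (abs_nonneg _) (hd l)) (norm_nonneg _) (hU1 _ _)
    _ = n := by simp

lemma exists_weakMaj_absSpecVec_map {n : ℕ}
    {T : Matrix (Fin n) (Fin n) ℂ → Matrix (Fin n) (Fin n) ℂ} (hTlin : IsLinearMap ℝ T)
    (hT : ∀ X : Matrix (Fin n) (Fin n) ℂ, X.IsHermitian → (T X).IsHermitian) :
    ∃ q : Fin n → ℝ, DecrNonneg q ∧ ∀ X : Matrix (Fin n) (Fin n) ℂ, X.IsHermitian →
      WeakMaj (absSpecVec (T X)) (q * absSpecVec X) := by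
  obtain ⟨C, hC, hTC⟩ := exists_entry_bound hTlin
  set K : ℝ := n * (n * n * (C * n)) with hK
  have hK0 : 0 ≤ K := by positivity
  have hq : DecrNonneg (fun _ : Fin n => K) := ⟨antitone_const, fun _ => hK0⟩
  refine ⟨fun _ => K, hq, fun X hX => weakMaj_absSpecVec_map_of_conjDiag hTlin hT hq ?_ hX⟩
  intro U hU d j k hj1 hj hk1 hk hd
  have hd1 : ∀ l, |d l| ≤ 1 := fun l => (hd l).trans (by split_ifs <;> norm_num)
  have hb := absSpecVec_le_of_entry_bound (hT _ (isHermitian_conjDiag U d))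
    (hTC _ n (Nat.cast_nonneg n) (norm_conjDiag_apply_le hU hd1))
  calc prefixSum (absSpecVec (T (conjDiag U d))) k
      ≤ ∑ _i : Fin n, n * n * (C * n) := Finset.sum_le_sum fun i _ => by
        split_ifs
        · exact hb i
        · positivity
    _ = K := by simp [hK]
    _ = (if (⟨0, by omega⟩ : Fin n).val < min k j then K else 0) := by
        rw [if_pos (by simp; omega)]
    _ ≤ prefixSum (fun _ : Fin n => K) (min k j) :=
        Finset.single_le_sum (f := fun i : Fin n => if i.val < min k j then K else 0)
          (fun i _ => by positivity) (Finset.mem_univ _)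

theorem exists_unique_least_vector (n : ℕ) (T : Matrix (Fin n) (Fin n) ℂ → Matrix (Fin n) (Fin n) ℂ)
    (hTlin : IsLinearMap ℝ T)
    (hT : ∀ X : Matrix (Fin n) (Fin n) ℂ, X.IsHermitian → (T X).IsHermitian) :
    ∃! q : Fin n → ℝ, DecrNonneg q ∧
      (∀ X : Matrix (Fin n) (Fin n) ℂ, X.IsHermitian →
        WeakMaj (absSpecVec (T X)) (q * absSpecVec X)) ∧
      ∀ q' : Fin n → ℝ, DecrNonneg q' →
        (∀ X : Matrix (Fin n) (Fin n) ℂ, X.IsHermitian →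
          WeakMaj (absSpecVec (T X)) (q' * absSpecVec X)) → WeakMaj q q' := by
  set F : Set (Fin n → ℝ) := {q | DecrNonneg q ∧
    ∀ X : Matrix (Fin n) (Fin n) ℂ, X.IsHermitian →
      WeakMaj (absSpecVec (T X)) (q * absSpecVec X)} with hF
  obtain ⟨q, hq, hglb⟩ := exists_isGLB_prefixSum (F := F)
    (exists_weakMaj_absSpecVec_map hTlin hT) fun p hp => hp.1
  have hqF : ∀ X : Matrix (Fin n) (Fin n) ℂ, X.IsHermitian →
      WeakMaj (absSpecVec (T X)) (q * absSpecVec X) := by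
    refine fun X hX => weakMaj_absSpecVec_map_of_conjDiag hTlin hT hq ?_ hX
    intro U hU d j k hj1 hj hk1 hk hd
    refine (hglb (min k j) ((min_le_left _ _).trans hk)).2 ?_
    rintro _ ⟨p, hp, rfl⟩
    have hE := isHermitian_conjDiag U d
    exact ((weakMaj_iff_prefixSum (decrNonneg_absSpecVec _)
      (hp.1.mul (decrNonneg_absSpecVec _))).mp (hp.2 _ hE) k hk1 hk).trans
      (prefixSum_mul_absSpecVec_conjDiag_le hU hj hd hp.1 hk)
  have hleast : ∀ q' ∈ F, WeakMaj q q' := fun q' hq' =>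
    (weakMaj_iff_prefixSum hq hq'.1).mpr fun k _ hk => (hglb k hk).1 ⟨q', hq', rfl⟩
  refine ⟨q, ⟨hq, hqF, fun q' h1 h2 => hleast q' ⟨h1, h2⟩⟩, ?_⟩
  rintro q' ⟨h1, h2, h3⟩
  exact eq_of_weakMaj_weakMaj h1 hq (h3 q hq hqF) (hleast q' ⟨h1, h2⟩)
end
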